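/- Fix an integer b with 12 ≤ b ≤ 35. There are constants c₂ > c₁ > 0 (depending only on b) such that for all sufficiently large integers N, the integral 𝒥(N) = ∫_{−∞}^{∞} v₂(β) v₃(β)² v₃*(β)² v₄(β) v_b(β) e(−βN) dβ is a real number satisfying c₁·N^{35/36 + 1/b} ≤ 𝒥(N) ≤ c₂·N^{35/36 + 1/b}. -/

import Mathlib

open scoped Classical
open Finset

noncomputable section

/-- `e(x) = e^{2πix}`. -/
def eR (x : ℝ) : ℂ := Complex.exp (2 * Real.pi * x * Complex.I)

/-- `U_k = (1/k) N^{1/k}`. -/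
def U (N k : ℕ) : ℝ := (N : ℝ) ^ ((1 : ℝ) / k) / k

/-- `U₃* = (1/3) N^{5/18}`. -/
def U3s (N : ℕ) : ℝ := (N : ℝ) ^ ((5 : ℝ) / 18) / 3

/-- `v_k(β) = ∫_{U_k}^{2U_k} e(β u^k) du`. -/
def v (N k : ℕ) (β : ℝ) : ℂ := ∫ u in U N k..(2 * U N k), eR (β * u ^ k)

/-- `v₃*(β) = ∫_{U₃*}^{2U₃*} e(β u³) du`. -/
def v3s (N : ℕ) (β : ℝ) : ℂ := ∫ u in U3s N..(2 * U3s N), eR (β * u ^ 3)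

/-- The singular integral `𝒥(N)`. -/
def SingInt (b N : ℕ) : ℂ :=
  ∫ β : ℝ, v N 2 β * (v N 3 β) ^ 2 * (v3s N β) ^ 2 * v N 4 β * v N b β * eR (-(β * N))


open MeasureTheory

/-- `∫_a^{2a} e(β u^k) du`. -/
def vv (a : ℝ) (k : ℕ) (β : ℝ) : ℂ := ∫ u in a..(2 * a), eR (β * u ^ k)

lemma eR_norm (x : ℝ) : ‖eR x‖ = 1 := by
  unfold eR
  have : (2 * Real.pi * x * Complex.I : ℂ) = ((2 * Real.pi * x : ℝ) : ℂ) * Complex.I := by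
    push_cast; ring
  rw [this, Complex.norm_exp_ofReal_mul_I]

lemma eR_add (x y : ℝ) : eR (x + y) = eR x * eR y := by
  unfold eR
  rw [← Complex.exp_add]
  congr 1
  push_cast; ring

lemma eR_cont : Continuous eR := by
  unfold eR
  fun_prop

lemma vv_cont (a : ℝ) (k : ℕ) : Continuous (vv a k) := by
  unfold vv
  apply intervalIntegral.continuous_parametric_intervalIntegral_of_continuous'
  have := eR_cont
  unfold Function.uncurry
  fun_prop

lemma vv_bound (a : ℝ) (ha : 0 < a) (k : ℕ) (β : ℝ) : ‖vv a k β‖ ≤ a := by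
  unfold vv
  have := intervalIntegral.norm_integral_le_of_norm_le_const (a := a) (b := 2 * a) (C := 1)
    (f := fun u => eR (β * u ^ k)) (fun x _ => (eR_norm _).le)
  refine this.trans (le_of_eq ?_)
  rw [show 2 * a - a = a by ring, abs_of_pos ha, one_mul]

lemma vv_decay (a : ℝ) (ha : 0 < a) (k : ℕ) (hk : 1 ≤ k) :
    ∃ C : ℝ, ∀ β : ℝ, |β| * ‖vv a k β‖ ≤ C := by
  obtain ⟨n, rfl⟩ : ∃ n, k = n + 1 := ⟨k - 1, by omega⟩
  refine ⟨2 * (a ^ n)⁻¹ + n * (a ^ (n + 1))⁻¹ * a, fun β => ?_⟩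
  have hsub : ∀ u ∈ Set.uIcc a (2 * a), a ≤ u := by
    intro u hu
    rw [Set.uIcc_of_le (by linarith)] at hu
    exact hu.1
  set c : ℂ := 2 * Real.pi * β * (n + 1) * Complex.I with hc
  -- derivative
  have hder : ∀ u ∈ Set.uIcc a (2 * a),
      HasDerivAt (fun u : ℝ => eR (β * u ^ (n + 1)) * ((u : ℂ) ^ n)⁻¹)
        (c * eR (β * u ^ (n + 1)) - n * (((u : ℂ) ^ (n + 1))⁻¹ * eR (β * u ^ (n + 1)))) u := by
    intro u hu
    have hu0 : 0 < u := lt_of_lt_of_le ha (hsub u hu)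
    have huc : (u : ℂ) ≠ 0 := by exact_mod_cast hu0.ne'
    have h1 : HasDerivAt (fun z : ℂ => Complex.exp (2 * Real.pi * (β * z ^ (n + 1)) * Complex.I)
        * (z ^ n)⁻¹) (c * eR (β * u ^ (n + 1)) - n * (((u : ℂ) ^ (n + 1))⁻¹ * eR (β * u ^ (n + 1))))
        (u : ℂ) := by
      have hp := hasDerivAt_pow (n + 1) (u : ℂ)
      have h2 := ((((hp.const_mul (β : ℂ)).const_mul (2 * (Real.pi : ℂ))).mul_const
        Complex.I).cexp).mul ((hasDerivAt_pow n (u : ℂ)).inv (pow_ne_zero n huc))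
      refine h2.congr_deriv ?_
      have he : eR (β * u ^ (n + 1)) =
          Complex.exp (2 * Real.pi * (β * (u : ℂ) ^ (n + 1)) * Complex.I) := by
        unfold eR; push_cast; rfl
      rw [he, hc]
      generalize Complex.exp (2 * Real.pi * (β * (u : ℂ) ^ (n + 1)) * Complex.I) = E
      rcases n with _ | m
      · simp; ring
      · simp only [Nat.add_sub_cancel, Pi.inv_apply]
        push_cast
        field_simp
        ring
    have h3 := h1.comp_ofReal
    refine h3.congr_of_eventuallyEq (Filter.Eventually.of_forall fun x => ?_)
    simp only [eR]
    push_cast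
    rfl
  have hec : Continuous fun u : ℝ => eR (β * u ^ (n + 1)) := eR_cont.comp (by fun_prop)
  have hI1 : IntervalIntegrable (fun u : ℝ => c * eR (β * u ^ (n + 1))) volume a (2 * a) :=
    (continuous_const.mul hec).intervalIntegrable _ _
  have hI2 : IntervalIntegrable (fun u : ℝ => (n : ℂ) * (((u : ℂ) ^ (n + 1))⁻¹ * eR (β * u ^ (n + 1))))
      volume a (2 * a) := by
    apply ContinuousOn.intervalIntegrable
    refine continuousOn_const.mul (ContinuousOn.mul (ContinuousOn.inv₀ (by fun_prop) ?_) hec.continuousOn)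
    intro u hu
    have hu0 : 0 < u := lt_of_lt_of_le ha (hsub u hu)
    exact pow_ne_zero _ (by exact_mod_cast hu0.ne')
  have hF := intervalIntegral.integral_eq_sub_of_hasDerivAt hder (hI1.sub hI2)
  rw [intervalIntegral.integral_sub hI1 hI2, intervalIntegral.integral_const_mul] at hF
  change c * vv a (n + 1) β - _ = _ at hF
  have hF' := eq_add_of_sub_eq hF
  have hb1 : ∀ u : ℝ, a ≤ u → ‖eR (β * u ^ (n + 1)) * ((u : ℂ) ^ n)⁻¹‖ ≤ (a ^ n)⁻¹ := by
    intro u hu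
    rw [norm_mul, eR_norm, one_mul, norm_inv, norm_pow, Complex.norm_real, Real.norm_eq_abs,
      abs_of_pos (lt_of_lt_of_le ha hu)]
    gcongr
  have hb2 : ‖∫ u in a..(2 * a), (n : ℂ) * (((u : ℂ) ^ (n + 1))⁻¹ * eR (β * u ^ (n + 1)))‖
      ≤ n * (a ^ (n + 1))⁻¹ * |2 * a - a| := by
    apply intervalIntegral.norm_integral_le_of_norm_le_const
    intro u hu
    have hu := hsub u (Set.uIoc_subset_uIcc hu)
    rw [norm_mul, norm_mul, eR_norm, mul_one, norm_inv, norm_pow, Complex.norm_real, Real.norm_eq_abs,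
      abs_of_pos (lt_of_lt_of_le ha hu), Complex.norm_natCast]
    gcongr
  rw [show 2 * a - a = a by ring, abs_of_pos ha] at hb2
  have hcn : |β| ≤ ‖c‖ := by
    rw [hc]
    have : (2 * Real.pi * β * (n + 1) * Complex.I : ℂ)
      = ((2 * Real.pi * (n + 1) * β : ℝ) : ℂ) * Complex.I := by push_cast; ring
    rw [this, norm_mul, Complex.norm_I, mul_one, Complex.norm_real, Real.norm_eq_abs, abs_mul]
    have h1 : (1 : ℝ) ≤ |2 * Real.pi * (n + 1)| := by
      rw [abs_of_pos (by positivity)]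
      nlinarith [Real.pi_gt_three, (Nat.cast_nonneg n : (0 : ℝ) ≤ n)]
    nlinarith [abs_nonneg β]
  calc |β| * ‖vv a (n + 1) β‖ ≤ ‖c‖ * ‖vv a (n + 1) β‖ := by gcongr
    _ = ‖c * vv a (n + 1) β‖ := (norm_mul _ _).symm
    _ ≤ _ := by
      rw [hF']
      refine (norm_add_le _ _).trans (add_le_add ((norm_sub_le _ _).trans ?_) hb2)
      have := hb1 a le_rfl
      have := hb1 (2 * a) (by linarith)
      linarith

/-- `ρ` is a density with transform `F`, continuous and bounded between `m` and `M`
on the open interval `(A, B)`. -/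
structure Good (ρ : ℝ → ℝ) (F : ℝ → ℂ) (A B m M : ℝ) : Prop where
  meas : Measurable ρ
  int : Integrable ρ
  trans : ∀ β, ∫ t, (ρ t : ℂ) * eR (β * t) = F β
  cont : ContinuousOn ρ (Set.Ioo A B)
  lower : ∀ t ∈ Set.Ioo A B, m ≤ ρ t
  upper : ∀ t ∈ Set.Ioo A B, ρ t ≤ M

lemma Good.base (a : ℝ) (ha : 0 < a) :
    ∃ ρ, Good ρ (vv a 2) (a ^ 2) (4 * a ^ 2) (1 / (4 * a)) (1 / (2 * a)) := by
  have hlt : a ^ 2 ≤ 4 * a ^ 2 := by nlinarith [sq_nonneg a]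
  have hpos : 0 < a ^ 2 := by positivity
  have hcont : ContinuousOn (fun t : ℝ => 1 / (2 * √t)) (Set.Icc (a ^ 2) (4 * a ^ 2)) := by
    apply ContinuousOn.div (by fun_prop) (by fun_prop)
    intro t ht
    have : 0 < √t := Real.sqrt_pos.mpr (lt_of_lt_of_le hpos ht.1)
    positivity
  refine ⟨Set.indicator (Set.Ioc (a ^ 2) (4 * a ^ 2)) (fun t => 1 / (2 * √t)), ?_, ?_, ?_, ?_, ?_, ?_⟩
  · exact Measurable.indicator (by fun_prop) measurableSet_Ioc
  · rw [integrable_indicator_iff measurableSet_Ioc]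
    exact (hcont.integrableOn_Icc).mono_set Set.Ioc_subset_Icc_self
  · intro β
    have h1 : (fun t => ((Set.indicator (Set.Ioc (a ^ 2) (4 * a ^ 2)) (fun t => 1 / (2 * √t)) t : ℝ) : ℂ)
        * eR (β * t)) = Set.indicator (Set.Ioc (a ^ 2) (4 * a ^ 2))
          (fun t => ((1 / (2 * √t) : ℝ) : ℂ) * eR (β * t)) := by
      ext t
      by_cases ht : t ∈ Set.Ioc (a ^ 2) (4 * a ^ 2)
      · simp only [Set.indicator_of_mem ht]
      · simp only [Set.indicator_of_notMem ht]; simp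
    rw [h1, integral_indicator measurableSet_Ioc, ← intervalIntegral.integral_of_le hlt]
    have h2 := intervalIntegral.integral_deriv_smul_comp' (a := a) (b := 2 * a)
      (f := fun x : ℝ => x ^ 2) (f' := fun x => 2 * x)
      (g := fun t => ((1 / (2 * √t) : ℝ) : ℂ) * eR (β * t))
      (fun x _ => by simpa using hasDerivAt_pow 2 x) (by fun_prop) (by
        apply ContinuousOn.mul
        · apply Complex.continuous_ofReal.comp_continuousOn
          apply hcont.mono
          rintro _ ⟨x, hx, rfl⟩
          rw [Set.uIcc_of_le (by linarith)] at hx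
          constructor
          · nlinarith [hx.1]
          · nlinarith [hx.1, hx.2]
        · exact (eR_cont.comp (by fun_prop)).continuousOn)
    simp only at h2
    rw [show (2 * a) ^ 2 = 4 * a ^ 2 by ring] at h2
    rw [← h2]
    unfold vv
    apply intervalIntegral.integral_congr
    intro x hx
    rw [Set.uIcc_of_le (by linarith)] at hx
    have hx0 : 0 < x := lt_of_lt_of_le ha hx.1
    have hxc : (x : ℂ) ≠ 0 := by exact_mod_cast hx0.ne'
    simp only [Function.comp, Real.sqrt_sq hx0.le, Complex.real_smul]
    push_cast
    field_simp
  · refine (hcont.mono Set.Ioo_subset_Icc_self).congr ?_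
    intro t ht
    exact Set.indicator_of_mem (Set.Ioo_subset_Ioc_self ht) _
  · intro t ht
    rw [Set.indicator_of_mem (Set.Ioo_subset_Ioc_self ht)]
    have h1 : √t ≤ 2 * a := by
      rw [Real.sqrt_le_left (by linarith)]
      nlinarith [ht.2]
    have : 0 < √t := Real.sqrt_pos.mpr (lt_trans hpos ht.1)
    apply one_div_le_one_div_of_le <;> nlinarith
  · intro t ht
    rw [Set.indicator_of_mem (Set.Ioo_subset_Ioc_self ht)]
    have h1 : a ≤ √t := Real.le_sqrt_of_sq_le ht.1.le
    apply one_div_le_one_div_of_le <;> nlinarith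

lemma Good.step {ρ : ℝ → ℝ} {F : ℝ → ℂ} {A B m M : ℝ} (h : Good ρ F A B m M)
    (a : ℝ) (ha : 0 < a) (k : ℕ) :
    ∃ ρ', Good ρ' (fun β => F β * vv a k β) (A + (2 * a) ^ k) (B + a ^ k) (a * m) (a * M) := by
  have hle : a ≤ 2 * a := by linarith
  set ν : Measure ℝ := volume.restrict (Set.Ioc a (2 * a)) with hν
  have hjm : Measurable (fun p : ℝ × ℝ => ρ (p.1 - p.2 ^ k)) := h.meas.comp (by fun_prop)
  have hji : Integrable (fun p : ℝ × ℝ => ρ (p.1 - p.2 ^ k)) (volume.prod ν) := by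
    rw [integrable_prod_iff' hjm.aestronglyMeasurable]
    refine ⟨Filter.Eventually.of_forall fun u => h.int.comp_sub_right (u ^ k), ?_⟩
    have : ∀ u : ℝ, ∫ x, ‖ρ (x - u ^ k)‖ = ∫ x, ‖ρ x‖ := fun u =>
      integral_sub_right_eq_self (fun x => ‖ρ x‖) (u ^ k)
    simp only [this]
    exact integrable_const _
  have hmem : ∀ t ∈ Set.Ioo (A + (2 * a) ^ k) (B + a ^ k), ∀ u ∈ Set.Icc a (2 * a),
      t - u ^ k ∈ Set.Ioo A B := by
    intro t ht u hu
    have h1 : a ^ k ≤ u ^ k := pow_le_pow_left₀ ha.le hu.1 k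
    have h2 : u ^ k ≤ (2 * a) ^ k := pow_le_pow_left₀ (ha.le.trans hu.1) hu.2 k
    constructor <;> linarith [ht.1, ht.2]
  have hii : ∀ t ∈ Set.Ioo (A + (2 * a) ^ k) (B + a ^ k),
      IntervalIntegrable (fun u => ρ (t - u ^ k)) volume a (2 * a) := by
    intro t ht
    apply ContinuousOn.intervalIntegrable_of_Icc hle
    exact h.cont.comp (by fun_prop) (fun u hu => hmem t ht u hu)
  refine ⟨fun t => ∫ u, ρ (t - u ^ k) ∂ν, ?_, ?_, ?_, ?_, ?_, ?_⟩
  · exact (hjm.stronglyMeasurable.integral_prod_right').measurable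
  · exact hji.integral_prod_left
  · intro β
    have hec : Continuous fun p : ℝ × ℝ => eR (β * p.1) := eR_cont.comp (by fun_prop)
    have hji2 : Integrable (fun p : ℝ × ℝ => (ρ (p.1 - p.2 ^ k) : ℂ) * eR (β * p.1))
        (volume.prod ν) := by
      apply (hji.ofReal (𝕜 := ℂ)).mul_bdd (c := 1) hec.aestronglyMeasurable
      exact Filter.Eventually.of_forall fun p => (eR_norm _).le
    calc ∫ t, ((∫ u, ρ (t - u ^ k) ∂ν : ℝ) : ℂ) * eR (β * t)
        = ∫ t, ∫ u, (ρ (t - u ^ k) : ℂ) * eR (β * t) ∂ν := by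
          congr 1; ext t
          rw [integral_mul_const, integral_complex_ofReal]
      _ = ∫ u, (∫ t, (ρ (t - u ^ k) : ℂ) * eR (β * t)) ∂ν := integral_integral_swap hji2
      _ = ∫ u, F β * eR (β * u ^ k) ∂ν := by
          congr 1; ext u
          rw [← h.trans β, ← integral_mul_const,
            ← integral_add_right_eq_self (fun t => (ρ (t - u ^ k) : ℂ) * eR (β * t)) (u ^ k)]
          congr 1; ext t
          rw [add_sub_cancel_right, mul_add, eR_add, mul_assoc]
      _ = F β * vv a k β := by
          rw [integral_const_mul, vv, intervalIntegral.integral_of_le hle]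
  · intro t₀ ht₀
    apply ContinuousAt.continuousWithinAt
    have hν2 : (fun t => ∫ u, ρ (t - u ^ k) ∂ν) = fun t => ∫ u in a..(2 * a), ρ (t - u ^ k) := by
      ext t; rw [intervalIntegral.integral_of_le hle]
    rw [hν2]
    have hsub : ∀ u ∈ Set.uIoc a (2 * a), u ∈ Set.Icc a (2 * a) := by
      intro u hu
      rw [Set.uIoc_of_le hle] at hu
      exact Set.Ioc_subset_Icc_self hu
    apply intervalIntegral.continuousAt_of_dominated_interval (bound := fun _ => max |m| |M|)
    · exact Filter.Eventually.of_forall fun t => (h.meas.comp (by fun_prop)).aestronglyMeasurable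
    · filter_upwards [isOpen_Ioo.mem_nhds ht₀] with t ht
      refine Filter.Eventually.of_forall fun u hu => ?_
      have hm := hmem t ht u (hsub u hu)
      have h1 := h.lower _ hm
      have h2 := h.upper _ hm
      rw [Real.norm_eq_abs]
      exact abs_le_max_abs_abs h1 h2
    · exact intervalIntegrable_const
    · refine Filter.Eventually.of_forall fun u hu => ?_
      have hc := h.cont.continuousAt (isOpen_Ioo.mem_nhds (hmem t₀ ht₀ u (hsub u hu)))
      exact ContinuousAt.comp (f := fun t => t - u ^ k) hc (by fun_prop)
  · intro t ht
    rw [hν, ← intervalIntegral.integral_of_le hle]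
    calc a * m = ∫ u in a..(2 * a), m := by
          rw [intervalIntegral.integral_const, smul_eq_mul]; ring
      _ ≤ _ := intervalIntegral.integral_mono_on hle intervalIntegrable_const (hii t ht)
          (fun u hu => h.lower _ (hmem t ht u hu))
  · intro t ht
    rw [hν, ← intervalIntegral.integral_of_le hle]
    calc _ ≤ ∫ u in a..(2 * a), M := intervalIntegral.integral_mono_on hle (hii t ht)
          intervalIntegrable_const (fun u hu => h.upper _ (hmem t ht u hu))
      _ = a * M := by
          rw [intervalIntegral.integral_const, smul_eq_mul]; ring

open FourierTransform in
lemma Good.inversion {ρ : ℝ → ℝ} {F : ℝ → ℂ} {A B m M : ℝ} (h : Good ρ F A B m M)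
    (hF : Integrable F) (x : ℝ) (hx : x ∈ Set.Ioo A B) :
    ∫ β, F β * eR (-(β * x)) = ρ x := by
  have h1 : 𝓕⁻ (fun t => (ρ t : ℂ)) = F := by
    ext β
    rw [Real.fourierInv_eq', ← h.trans β]
    congr 1; ext t
    rw [smul_eq_mul, mul_comm]
    unfold eR
    congr 2
    simp
  have h2 : Integrable (𝓕 (fun t => (ρ t : ℂ))) := by
    have : 𝓕 (fun t => (ρ t : ℂ)) = fun β => F (-β) := by
      ext β
      rw [← h1, Real.fourierInv_eq_fourier_neg, neg_neg]
    rw [this]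
    exact hF.comp_neg
  have h3 := (h.int.ofReal (𝕜 := ℂ)).fourier_fourierInv_eq h2 (v := x) (by
    exact Complex.continuous_ofReal.continuousAt.comp (h.cont.continuousAt (isOpen_Ioo.mem_nhds hx)))
  have h4 : 𝓕 (𝓕⁻ (fun t => (ρ t : ℂ))) x = ρ x := h3
  rw [← h4, h1, Real.fourier_real_eq_integral_exp_smul]
  congr 1; ext β
  rw [smul_eq_mul, mul_comm]
  unfold eR
  congr 2
  push_cast
  ring

lemma integrable_two {a b : ℝ} (ha : 0 < a) (hb : 0 < b) (k l : ℕ) (hk : 1 ≤ k) (hl : 1 ≤ l) :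
    Integrable (fun β => vv a k β * vv b l β) := by
  obtain ⟨C, hC⟩ := vv_decay a ha k hk
  obtain ⟨D, hD⟩ := vv_decay b hb l hl
  refine Integrable.mono' (integrable_inv_one_add_sq.const_mul (a * b + C * D))
    ((vv_cont a k).mul (vv_cont b l)).aestronglyMeasurable (Filter.Eventually.of_forall fun β => ?_)
  rw [← div_eq_mul_inv, le_div_iff₀ (by positivity), norm_mul]
  have h1 := mul_le_mul (vv_bound a ha k β) (vv_bound b hb l β) (norm_nonneg _) ha.le
  have h2 := mul_le_mul (hC β) (hD β) (by positivity)
    (le_trans (by positivity) (hC 0))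
  have h3 : |β| * ‖vv a k β‖ * (|β| * ‖vv b l β‖) = ‖vv a k β‖ * ‖vv b l β‖ * β ^ 2 := by
    rw [← sq_abs β]; ring
  linarith

lemma integrable_mul_vv {F : ℝ → ℂ} (hF : Integrable F) {a : ℝ} (ha : 0 < a) (k : ℕ) :
    Integrable (fun β => F β * vv a k β) :=
  hF.mul_bdd (c := a) (vv_cont a k).aestronglyMeasurable
    (Filter.Eventually.of_forall fun β => vv_bound a ha k β)

lemma U_pow (N k : ℕ) (hk : k ≠ 0) : (U N k) ^ k = N / (k : ℝ) ^ k := by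
  unfold U
  rw [div_pow, one_div, Real.rpow_inv_natCast_pow (by positivity) hk]

theorem stmt19 (b : ℕ) (hb1 : 12 ≤ b) (hb2 : b ≤ 35) :
    ∃ c₁ c₂ : ℝ, 0 < c₁ ∧ c₁ < c₂ ∧ ∃ N₀ : ℕ, ∀ N : ℕ, N₀ ≤ N →
      (SingInt b N).im = 0 ∧
      c₁ * (N : ℝ) ^ ((35 : ℝ) / 36 + 1 / b) ≤ (SingInt b N).re ∧
      (SingInt b N).re ≤ c₂ * (N : ℝ) ^ ((35 : ℝ) / 36 + 1 / b) := by
  have hb0 : (0 : ℝ) < b := by positivity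
  refine ⟨1 / (648 * b), 2 / (648 * b), by positivity, by gcongr; norm_num, 20 ^ 6, fun N hN => ?_⟩
  have hN' : (20 : ℝ) ^ 6 ≤ N := by exact_mod_cast hN
  have hNpos : (0 : ℝ) < N := by linarith
  have hU : ∀ k : ℕ, k ≠ 0 → 0 < U N k := by
    intro k hk
    unfold U
    have : (0 : ℝ) < k := by positivity
    positivity
  have hUs : 0 < U3s N := by unfold U3s; positivity
  have h2 := hU 2 (by norm_num)
  have h3 := hU 3 (by norm_num)
  have h4 := hU 4 (by norm_num)
  have hbb := hU b (by omega)
  obtain ⟨ρ0, g0⟩ := Good.base (U N 2) h2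
  obtain ⟨ρ1, g1⟩ := g0.step (U N 3) h3 3
  obtain ⟨ρ2, g2⟩ := g1.step (U N 3) h3 3
  obtain ⟨ρ3, g3⟩ := g2.step (U3s N) hUs 3
  obtain ⟨ρ4, g4⟩ := g3.step (U3s N) hUs 3
  obtain ⟨ρ5, g5⟩ := g4.step (U N 4) h4 4
  obtain ⟨ρ6, g6⟩ := g5.step (U N b) hbb b
  have hI := integrable_mul_vv (integrable_mul_vv (integrable_mul_vv (integrable_mul_vv
    (integrable_mul_vv (integrable_two h2 h3 2 3 (by norm_num) (by norm_num)) h3 3) hUs 3) hUs 3)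
    h4 4) hbb b
  have hx : (N : ℝ) ∈ Set.Ioo (U N 2 ^ 2 + (2 * U N 3) ^ 3 + (2 * U N 3) ^ 3 + (2 * U3s N) ^ 3
      + (2 * U3s N) ^ 3 + (2 * U N 4) ^ 4 + (2 * U N b) ^ b)
      (4 * U N 2 ^ 2 + U N 3 ^ 3 + U N 3 ^ 3 + U3s N ^ 3 + U3s N ^ 3 + U N 4 ^ 4 + U N b ^ b) := by
    have e2 := U_pow N 2 (by norm_num)
    constructor
    · have e3 := U_pow N 3 (by norm_num)
      have e4 := U_pow N 4 (by norm_num)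
      have eb := U_pow N b (by omega)
      set x : ℝ := (N : ℝ) ^ ((1 : ℝ) / 6) with hxd
      have hx0 : 0 < x := by positivity
      have hx6 : x ^ 6 = N := by
        rw [hxd, ← Real.rpow_natCast, ← Real.rpow_mul hNpos.le]; norm_num
      have hx20 : 20 ≤ x := by
        by_contra hlt
        push Not at hlt
        have := pow_lt_pow_left₀ hlt hx0.le (n := 6) (by norm_num)
        linarith
      have es : U3s N ^ 3 = x ^ 5 / 27 := by
        unfold U3s
        rw [div_pow, hxd, ← Real.rpow_natCast (_ ^ _) 3, ← Real.rpow_natCast (_ ^ _) 5,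
          ← Real.rpow_mul hNpos.le, ← Real.rpow_mul hNpos.le]
        norm_num
      have hs : x ^ 5 * 20 ≤ N := by
        rw [← hx6, pow_succ x 5]
        gcongr
      have hbs : (2 / (b : ℝ)) ^ b ≤ 1 / 100 := by
        have hb12 : (12 : ℝ) ≤ b := by exact_mod_cast hb1
        have hle : 2 / (b : ℝ) ≤ 1 / 6 := by
          rw [div_le_div_iff₀ hb0 (by norm_num)]; linarith
        calc (2 / (b : ℝ)) ^ b ≤ (1 / 6) ^ b := by gcongr
          _ ≤ (1 / 6) ^ 12 := pow_le_pow_of_le_one (by norm_num) (by norm_num) hb1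
          _ ≤ _ := by norm_num
      have hbt : (2 * U N b) ^ b ≤ 1 / 100 * N := by
        rw [mul_pow, eb]
        calc (2 : ℝ) ^ b * (N / (b : ℝ) ^ b) = (2 / (b : ℝ)) ^ b * N := by rw [div_pow]; ring
          _ ≤ _ := by gcongr
      rw [mul_pow, mul_pow, mul_pow, e2, e3, e4, es]
      push_cast
      linarith
    · have : 0 < U N 3 ^ 3 := by positivity
      have : 0 < U3s N ^ 3 := by positivity
      have : 0 < U N 4 ^ 4 := by positivity
      have : 0 < U N b ^ b := by positivity
      push_cast at e2
      linarith
  have hJ : SingInt b N = ρ6 N := by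
    rw [← g6.inversion hI N hx]
    unfold SingInt
    congr 1; ext β
    have hv : ∀ k, v N k β = vv (U N k) k β := fun k => rfl
    have hs : v3s N β = vv (U3s N) 3 β := rfl
    rw [hv, hv, hv, hv, hs]
    ring
  have hlo := g6.lower _ hx
  have hup := g6.upper _ hx
  have hpow : U N b * (U N 4 * (U3s N * (U3s N * (U N 3 * (U N 3 * (1 / (4 * U N 2)))))))
      = 1 / (648 * b) * (N : ℝ) ^ ((35 : ℝ) / 36 + 1 / b) := by
    have hexp : (N : ℝ) ^ ((35 : ℝ) / 36 + 1 / b) * (N : ℝ) ^ ((1 : ℝ) / 2) =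
        (N : ℝ) ^ ((1 : ℝ) / b) * ((N : ℝ) ^ ((1 : ℝ) / 4) * ((N : ℝ) ^ ((5 : ℝ) / 18) *
        ((N : ℝ) ^ ((5 : ℝ) / 18) * ((N : ℝ) ^ ((1 : ℝ) / 3) * (N : ℝ) ^ ((1 : ℝ) / 3))))) := by
      simp only [← Real.rpow_add hNpos]
      congr 1
      ring
    unfold U U3s
    push_cast
    have hp : (0 : ℝ) < (N : ℝ) ^ ((1 : ℝ) / 2) := by positivity
    generalize (N : ℝ) ^ ((1 : ℝ) / 2) = q2 at *
    generalize (N : ℝ) ^ ((1 : ℝ) / 3) = q3 at *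
    generalize (N : ℝ) ^ ((1 : ℝ) / 4) = q4 at *
    generalize (N : ℝ) ^ ((5 : ℝ) / 18) = q5 at *
    generalize (N : ℝ) ^ ((1 : ℝ) / b) = qb at *
    generalize (N : ℝ) ^ ((35 : ℝ) / 36 + 1 / b) = Q at *
    have : Q = qb * (q4 * (q5 * (q5 * (q3 * q3)))) / q2 := by
      rw [eq_div_iff hp.ne', hexp]
    rw [this]
    field_simp
    ring
  have hpow2 : U N b * (U N 4 * (U3s N * (U3s N * (U N 3 * (U N 3 * (1 / (2 * U N 2)))))))
      = 2 / (648 * b) * (N : ℝ) ^ ((35 : ℝ) / 36 + 1 / b) := by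
    have : 2 / (648 * b) * (N : ℝ) ^ ((35 : ℝ) / 36 + 1 / b) =
      2 * (1 / (648 * b) * (N : ℝ) ^ ((35 : ℝ) / 36 + 1 / b)) := by ring
    rw [this, ← hpow]
    field_simp
    norm_num
  rw [hJ]
  refine ⟨Complex.ofReal_im _, ?_, ?_⟩
  · rw [Complex.ofReal_re, ← hpow]
    exact hlo
  · rw [Complex.ofReal_re, ← hpow2]
    exact hup

end
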